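/- arXiv:1608.01156 — 5 statements merged into one kernel-verified Lean document; each statement's English description precedes it below -/
import Mathlib

section
/- Let S be a finite set and C = (c_st)_{s,t∈S} a matrix with integer entries. Then there exist a finite-dimensional real vector space V, a reduced crystallographic root system R in V, and a base {α_s : s ∈ S} of R whose Cartan matrix is C (i.e. ⟨α_t, α_s∨⟩ = c_st for all s, t ∈ S) if and only if C satisfies: (C1) c_ss = 2 for all s ∈ S; c_st ≤ 0 for all s ≠ t; and c_st ≠ 0 if and only if c_ts ≠ 0; and (C2) the symmetric real matrix M = (M_st) with M_ss = 1 and M_st = −√(c_st·c_ts)/2 for s ≠ t is positive definite. -/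
/-- A root system `R` in a finite-dimensional real vector space `V`: a finite subset
spanning `V` with `0 ∉ R`, such that for each `α ∈ R` there is a linear form `α∨`
with `⟨α, α∨⟩ = 2` whose reflection `s_α(x) = x - ⟨x, α∨⟩α` maps `R` onto `R`. -/
structure RealRootSystem : Type 1 where
  /-- the ambient real vector space -/
  V : Type
  [grp : AddCommGroup V]
  [mod : Module ℝ V]
  /-- the set of roots -/
  R : Set V
  finite_R : R.Finite
  spanning : Submodule.span ℝ R = ⊤
  zero_notMem : (0 : V) ∉ R
  /-- the coroot `α∨`, a linear form on `V` -/
  coroot : V → V →ₗ[ℝ] ℝ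
  coroot_self : ∀ α ∈ R, coroot α α = 2
  refl_image : ∀ α ∈ R, (fun x => x - coroot α x • α) '' R = R

attribute [instance] RealRootSystem.grp RealRootSystem.mod

namespace RealRootSystem

/-- Crystallographic: `⟨β, α∨⟩ ∈ ℤ` for all `α, β ∈ R`. -/
def IsCrystallographic (rs : RealRootSystem) : Prop :=
  ∀ α ∈ rs.R, ∀ β ∈ rs.R, ∃ n : ℤ, rs.coroot α β = (n : ℝ)

/-- Reduced: `R ∩ ℝα = {α, -α}` for every `α ∈ R`. -/
def IsReduced (rs : RealRootSystem) : Prop :=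
  ∀ α ∈ rs.R, {β | β ∈ rs.R ∧ ∃ c : ℝ, β = c • α} = ({α, -α} : Set rs.V)

/-- A base of `R` indexed by `S`: a linearly independent family in `R` such that
every root is a linear combination with coefficients all `≥ 0` or all `≤ 0`. -/
def IsBase (rs : RealRootSystem) {S : Type} [Fintype S] (b : S → rs.V) : Prop :=
  (∀ s, b s ∈ rs.R) ∧ LinearIndependent ℝ b ∧
    ∀ α ∈ rs.R, ∃ c : S → ℝ,
      α = ∑ s, c s • b s ∧ ((∀ s, 0 ≤ c s) ∨ (∀ s, c s ≤ 0))

end RealRootSystem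

namespace RealRootSystem

lemma refl_sum {rs : RealRootSystem} {α : rs.V} (hα : α ∈ rs.R) {M : Type*} [AddCommMonoid M]
    (F : rs.V → M) :
    ∑ β ∈ rs.finite_R.toFinset, F (β - rs.coroot α β • α) = ∑ β ∈ rs.finite_R.toFinset, F β := by
  have h2 := rs.coroot_self α hα
  have hinv : ∀ x : rs.V, (x - rs.coroot α x • α) -
      rs.coroot α (x - rs.coroot α x • α) • α = x := by
    intro x
    simp only [map_sub, map_smul, h2, smul_eq_mul]
    module
  have hmem : ∀ x ∈ rs.R, x - rs.coroot α x • α ∈ rs.R := by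
    intro x hx
    have := rs.refl_image α hα
    rw [← this]
    exact ⟨x, hx, rfl⟩
  refine Finset.sum_bij' (fun x _ => x - rs.coroot α x • α) (fun x _ => x - rs.coroot α x • α)
    ?_ ?_ ?_ ?_ ?_
  · intro x hx; simpa using hmem x (by simpa using hx)
  · intro x hx; simpa using hmem x (by simpa using hx)
  · intro x _; exact hinv x
  · intro x _; exact hinv x
  · intro x _; rfl

lemma phi_coroot {rs : RealRootSystem} {α : rs.V} (hα : α ∈ rs.R) :
    (2 : ℝ) • ∑ β ∈ rs.finite_R.toFinset, rs.coroot α β • β =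
      (∑ β ∈ rs.finite_R.toFinset, rs.coroot α β * rs.coroot α β) • α := by
  have h2 := rs.coroot_self α hα
  have h := refl_sum hα (fun β => rs.coroot α β • β)
  have h' : ∑ β ∈ rs.finite_R.toFinset,
      (rs.coroot α (β - rs.coroot α β • α)) • (β - rs.coroot α β • α)
      = (∑ β ∈ rs.finite_R.toFinset, rs.coroot α β * rs.coroot α β) • α
        - ∑ β ∈ rs.finite_R.toFinset, rs.coroot α β • β := by
    rw [Finset.sum_smul, ← Finset.sum_sub_distrib]
    refine Finset.sum_congr rfl fun β _ => ?_
    simp only [map_sub, map_smul, h2, smul_eq_mul]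
    module
  rw [h'] at h
  rw [two_smul]
  nth_rewrite 1 [← h]
  abel

end RealRootSystem

theorem cartan_forward {S : Type} [Fintype S] [DecidableEq S] (C : S → S → ℤ)
    (rs : RealRootSystem) (b : S → rs.V) (hb : rs.IsBase b)
    (hC : ∀ s t, rs.coroot (b s) (b t) = (C s t : ℝ)) :
    (∀ s, C s s = 2) ∧
         (∀ s t, s ≠ t → C s t ≤ 0) ∧
         (∀ s t, C s t ≠ 0 ↔ C t s ≠ 0) ∧
         (Matrix.of fun s t =>
             if s = t then (1 : ℝ)
             else -(Real.sqrt ((C s t : ℝ) * (C t s : ℝ))) / 2).PosDef := by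
  obtain ⟨hbR, hli, hbase⟩ := hb
  set T := rs.finite_R.toFinset with hT
  let G : S → S → ℝ := fun s t => ∑ β ∈ T, rs.coroot (b s) β * rs.coroot (b t) β
  have hphi : ∀ s, (2 : ℝ) • ∑ β ∈ T, rs.coroot (b s) β • β = G s s • b s :=
    fun s => RealRootSystem.phi_coroot (hbR s)
  have hGC : ∀ s t, 2 * G s t = G s s * C t s := by
    intro s t
    have := congrArg (rs.coroot (b t)) (hphi s)
    simpa [map_sum, hC, G] using this
  have hGsymm : ∀ s t, G s t = G t s := fun s t =>
    Finset.sum_congr rfl fun β _ => mul_comm _ _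
  have hGpos : ∀ s, 0 < G s s := by
    intro s
    refine Finset.sum_pos' (fun β _ => mul_self_nonneg _) ⟨b s, by simpa [hT] using hbR s, ?_⟩
    rw [rs.coroot_self _ (hbR s)]; norm_num
  have hdiag : ∀ s, C s s = 2 := by
    intro s
    have := hC s s
    rw [rs.coroot_self _ (hbR s)] at this
    exact_mod_cast this.symm
  have hle : ∀ s t, s ≠ t → C s t ≤ 0 := by
    intro s t hst
    have hmem : b t - rs.coroot (b s) (b t) • b s ∈ rs.R := by
      rw [← rs.refl_image (b s) (hbR s)]
      exact ⟨b t, hbR t, rfl⟩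
    obtain ⟨c, hc, hsgn⟩ := hbase _ hmem
    have h1 : b t - rs.coroot (b s) (b t) • b s =
        ∑ u, ((Pi.single t 1 : S → ℝ) u - (Pi.single s (C s t : ℝ) : S → ℝ) u) • b u := by
      simp [sub_smul, Finset.sum_sub_distrib, Pi.single_apply, ite_smul, hC]
    have h2 := (Fintype.linearIndependent_iffₛ.mp hli) _ _ (h1.symm.trans hc)
    have ht := h2 t
    have hs := h2 s
    simp [hst, hst.symm] at ht hs
    rcases hsgn with h | h
    · have := h s
      rw [← hs] at this
      have : (C s t : ℝ) ≤ 0 := by linarith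
      exact_mod_cast this
    · have := h t
      linarith
  have hC' : ∀ s t, (C s t : ℝ) = 2 * G s t / G t t := by
    intro s t
    rw [eq_div_iff (hGpos t).ne', hGsymm s t, hGC t s]; ring
  have hGle : ∀ s t, s ≠ t → G s t ≤ 0 := by
    intro s t hst
    have h1 : (C t s : ℝ) ≤ 0 := by exact_mod_cast hle t s hst.symm
    nlinarith [hGC s t, hGpos s]
  have hiff : ∀ s t, C s t = 0 ↔ G s t = 0 := by
    intro s t
    rw [← @Int.cast_eq_zero ℝ, hC', div_eq_zero_iff]
    simp [(hGpos t).ne']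
  have hsq : ∀ s, 0 < √(G s s) := fun s => Real.sqrt_pos.mpr (hGpos s)
  have hM : ∀ s t, (if s = t then (1 : ℝ)
             else -(Real.sqrt ((C s t : ℝ) * (C t s : ℝ))) / 2) = G s t / (√(G s s) * √(G t t)) := by
    intro s t
    split_ifs with h
    · subst h
      rw [Real.mul_self_sqrt (hGpos s).le, div_self (hGpos s).ne']
    · have : (C s t : ℝ) * C t s = (-(2 * G s t) / (√(G s s) * √(G t t))) ^ 2 := by
        rw [hC' s t, hC' t s, hGsymm t s, div_pow, mul_pow, Real.sq_sqrt (hGpos s).le,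
          Real.sq_sqrt (hGpos t).le]
        have := (hGpos s).ne'
        have := (hGpos t).ne'
        field_simp
      rw [this, Real.sqrt_sq]
      · ring
      · apply div_nonneg
        · linarith [hGle s t h]
        · exact (mul_pos (hsq s) (hsq t)).le
  refine ⟨hdiag, hle, fun s t => ?_, ?_⟩
  · rw [Ne, hiff, hGsymm, ← hiff]
  · simp_rw [hM]
    refine Matrix.PosDef.of_dotProduct_mulVec_pos ?_ ?_
    · ext s t
      simp [hGsymm t s, mul_comm]
    · intro x hx
      have hexp : star x ⬝ᵥ ((Matrix.of fun s t => G s t / (√(G s s) * √(G t t))).mulVec x)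
          = ∑ β ∈ T, (∑ s, x s / √(G s s) * rs.coroot (b s) β) ^ 2 := by
        have e1 : ∀ β, (∑ s, x s / √(G s s) * rs.coroot (b s) β) ^ 2 =
            ∑ s, ∑ t, x s / √(G s s) * (x t / √(G t t)) *
              (rs.coroot (b s) β * rs.coroot (b t) β) := by
          intro β
          rw [sq, Finset.sum_mul_sum]
          refine Finset.sum_congr rfl fun s _ => Finset.sum_congr rfl fun t _ => by ring
        simp_rw [e1]
        rw [Finset.sum_comm]
        simp only [dotProduct, Matrix.mulVec, Matrix.of_apply, Finset.mul_sum, star_trivial]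
        refine Finset.sum_congr rfl fun s _ => ?_
        rw [Finset.sum_comm]
        refine Finset.sum_congr rfl fun t _ => ?_
        rw [← Finset.mul_sum]
        change x s * (G s t / _ * x t) = _ * G s t
        have := (hsq s).ne'
        have := (hsq t).ne'
        field_simp
      rw [hexp]
      refine lt_of_le_of_ne (Finset.sum_nonneg fun β _ => sq_nonneg _) fun h0 => hx ?_
      rw [eq_comm, Finset.sum_eq_zero_iff_of_nonneg (fun β _ => sq_nonneg _)] at h0
      have h1 : ∑ s, (x s / √(G s s) * (G s s)) • b s = 0 := by
        simp_rw [mul_smul, ← hphi, Finset.smul_sum]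
        rw [Finset.sum_comm]
        refine Finset.sum_eq_zero fun β hβ => ?_
        have := pow_eq_zero_iff (two_ne_zero) |>.mp (h0 β hβ)
        have e : ∑ s, (x s / √(G s s)) • (2 : ℝ) • rs.coroot (b s) β • β =
          (2 * ∑ s, x s / √(G s s) * rs.coroot (b s) β) • β := by
          rw [Finset.mul_sum, Finset.sum_smul]
          refine Finset.sum_congr rfl fun s _ => ?_
          module
        rw [e, this]; simp
      have h2 := Fintype.linearIndependent_iff.mp hli _ h1
      ext s
      have := h2 s
      have h3 := (hsq s).ne'
      have h4 := (hGpos s).ne'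
      simpa [h3, h4] using this

section Backward

variable {S : Type} [Fintype S] [DecidableEq S]

lemma cartan_leaf (C : S → S → ℤ) (hle : ∀ s t, s ≠ t → C s t ≤ 0)
    (hz : ∀ s t, C s t ≠ 0 ↔ C t s ≠ 0)
    (hM : (Matrix.of fun s t =>
             if s = t then (1 : ℝ)
             else -(Real.sqrt ((C s t : ℝ) * (C t s : ℝ))) / 2).PosDef)
    (T : Finset S) (hT : T.Nonempty) :
    ∃ s ∈ T, ((T.erase s).filter (fun t => C s t ≠ 0)).card ≤ 1 := by
  by_contra! hcon
  let x : S → ℝ := fun s => if s ∈ T then 1 else 0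
  have hx : x ≠ 0 := by
    obtain ⟨s, hs⟩ := hT
    intro h
    have := congrFun h s
    simp [x, hs] at this
  have hpos := hM.dotProduct_mulVec_pos hx
  set m : S → S → ℝ := fun s t => if s = t then (1 : ℝ)
             else -(Real.sqrt ((C s t : ℝ) * (C t s : ℝ))) / 2 with hm
  have hexp : star x ⬝ᵥ ((Matrix.of m).mulVec x) = ∑ s ∈ T, ∑ t ∈ T, m s t := by
    simp [dotProduct, Matrix.mulVec, x, Finset.sum_ite_mem]
  rw [hexp] at hpos
  refine absurd hpos (not_lt.mpr (Finset.sum_nonpos fun s hs => ?_))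
  rw [← Finset.add_sum_erase _ _ hs]
  have h1 : m s s = 1 := by simp [hm]
  have h2 : ∑ t ∈ T.erase s, m s t ≤ ∑ t ∈ T.erase s, if C s t ≠ 0 then (-1 / 2 : ℝ) else 0 := by
    refine Finset.sum_le_sum fun t ht => ?_
    have hst : s ≠ t := (Finset.ne_of_mem_erase ht).symm
    simp only [hm, hst, if_false]
    split_ifs with h
    · have a1 : C s t ≤ -1 := by have := hle s t hst; omega
      have a2 : C t s ≤ -1 := by have := hle t s hst.symm; have := (hz s t).mp h; omega
      have a3 : (C s t : ℝ) ≤ -1 := by exact_mod_cast a1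
      have a4 : (C t s : ℝ) ≤ -1 := by exact_mod_cast a2
      have : (1 : ℝ) ≤ √((C s t : ℝ) * C t s) := by
        rw [Real.one_le_sqrt]; nlinarith
      linarith
    · have := Real.sqrt_nonneg ((C s t : ℝ) * C t s)
      linarith
  rw [← Finset.sum_filter, Finset.sum_const, nsmul_eq_mul] at h2
  have h3 : (2 : ℝ) ≤ (((T.erase s).filter (fun t => C s t ≠ 0)).card : ℝ) := by
    exact_mod_cast hcon s hs
  rw [h1]
  linarith

lemma cartan_symmetrizer (C : S → S → ℤ) (hle : ∀ s t, s ≠ t → C s t ≤ 0)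
    (hz : ∀ s t, C s t ≠ 0 ↔ C t s ≠ 0)
    (hM : (Matrix.of fun s t =>
             if s = t then (1 : ℝ)
             else -(Real.sqrt ((C s t : ℝ) * (C t s : ℝ))) / 2).PosDef) :
    ∃ N : S → ℝ, (∀ s, 0 < N s) ∧ ∀ s t, (C s t : ℝ) * N s = C t s * N t := by
  have key : ∀ T : Finset S, ∃ N : S → ℝ, (∀ s, 0 < N s) ∧
      ∀ s ∈ T, ∀ t ∈ T, (C s t : ℝ) * N s = C t s * N t := by
    intro T
    induction T using Finset.strongInduction with
    | H T ih =>
      rcases T.eq_empty_or_nonempty with rfl | hT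
      · exact ⟨fun _ => 1, fun _ => one_pos, by simp⟩
      · obtain ⟨s, hs, hcard⟩ := cartan_leaf C hle hz hM T hT
        obtain ⟨N, hN, hsym⟩ := ih _ (Finset.erase_ssubset hs)
        have hz' : ∀ u v, C u v = 0 → C v u = 0 := by
          intro u v h
          by_contra h'
          exact (hz v u).mp h' h
        suffices hv : ∃ v : ℝ, 0 < v ∧ ∀ t ∈ T.erase s, (C s t : ℝ) * v = C t s * N t by
          obtain ⟨v, hv, hvt⟩ := hv
          refine ⟨Function.update N s v, fun u => ?_, fun u hu w hw => ?_⟩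
          · by_cases h : u = s
            · subst h; simpa using hv
            · simpa [h] using hN u
          · by_cases h : u = s <;> by_cases h' : w = s
            · subst h; subst h'; rfl
            · subst h
              simpa [h'] using hvt w (Finset.mem_erase.mpr ⟨h', hw⟩)
            · subst h'
              simpa [h] using (hvt u (Finset.mem_erase.mpr ⟨h, hu⟩)).symm
            · simpa [h, h'] using
                hsym u (Finset.mem_erase.mpr ⟨h, hu⟩) w (Finset.mem_erase.mpr ⟨h', hw⟩)
        rcases Finset.eq_empty_or_nonempty ((T.erase s).filter (fun t => C s t ≠ 0)) with h0 | ⟨t, ht⟩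
        · refine ⟨1, one_pos, fun t ht => ?_⟩
          have : C s t = 0 := by
            by_contra h
            have : t ∈ (T.erase s).filter (fun t => C s t ≠ 0) := Finset.mem_filter.mpr ⟨ht, h⟩
            rw [h0] at this
            simp at this
          simp [this, hz' _ _ this]
        · have hst := (Finset.mem_filter.mp ht).2
          have hne : s ≠ t := (Finset.ne_of_mem_erase (Finset.mem_filter.mp ht).1).symm
          have a1 : (C s t : ℝ) < 0 := by
            exact_mod_cast lt_of_le_of_ne (hle s t hne) hst
          have a2 : (C t s : ℝ) < 0 := by
            exact_mod_cast lt_of_le_of_ne (hle t s hne.symm) ((hz s t).mp hst)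
          refine ⟨C t s * N t / C s t, div_pos_of_neg_of_neg (by nlinarith [hN t]) a1,
            fun u hu => ?_⟩
          by_cases h : C s u = 0
          · simp [h, hz' _ _ h]
          · have : u = t := Finset.card_le_one.mp hcard u (Finset.mem_filter.mpr ⟨hu, h⟩) t ht
            subst this
            field_simp
  obtain ⟨N, hN, h⟩ := key Finset.univ
  exact ⟨N, hN, fun s t => h s (Finset.mem_univ _) t (Finset.mem_univ _)⟩

/-- The symmetrized form attached to a Cartan matrix `C` and a symmetrizer `N`. -/
noncomputable def cartanForm (C : S → S → ℤ) (N : S → ℝ) : LinearMap.BilinForm ℝ (S → ℝ) :=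
  Matrix.toBilin' (Matrix.of fun s t => (C s t : ℝ) * N s / 2)

lemma cartanForm_apply (C : S → S → ℤ) (N : S → ℝ) (x y : S → ℝ) :
    cartanForm C N x y = ∑ s, ∑ t, x s * ((C s t : ℝ) * N s / 2) * y t := by
  simp [cartanForm, Matrix.toBilin'_apply]

lemma cartanForm_single (C : S → S → ℤ) (N : S → ℝ) (s t : S) :
    cartanForm C N (Pi.single s 1) (Pi.single t 1) = (C s t : ℝ) * N s / 2 := by
  simp [cartanForm]

lemma cartanForm_symm {C : S → S → ℤ} {N : S → ℝ}
    (hsym : ∀ s t, (C s t : ℝ) * N s = C t s * N t) (x y : S → ℝ) :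
    cartanForm C N x y = cartanForm C N y x := by
  rw [cartanForm_apply, cartanForm_apply, Finset.sum_comm]
  refine Finset.sum_congr rfl fun s _ => Finset.sum_congr rfl fun t _ => ?_
  rw [hsym]; ring

lemma cartanForm_pos {C : S → S → ℤ} {N : S → ℝ} (hdiag : ∀ s, C s s = 2)
    (hle : ∀ s t, s ≠ t → C s t ≤ 0) (hN : ∀ s, 0 < N s)
    (hsym : ∀ s t, (C s t : ℝ) * N s = C t s * N t)
    (hM : (Matrix.of fun s t =>
             if s = t then (1 : ℝ)
             else -(Real.sqrt ((C s t : ℝ) * (C t s : ℝ))) / 2).PosDef)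
    {x : S → ℝ} (hx : x ≠ 0) : 0 < cartanForm C N x x := by
  have hsq : ∀ s, 0 < √(N s) := fun s => Real.sqrt_pos.mpr (hN s)
  have hy : (fun s => √(N s) * x s) ≠ 0 := by
    intro h
    apply hx
    ext s
    have := congrFun h s
    simpa [(hsq s).ne'] using this
  have := hM.dotProduct_mulVec_pos hy
  refine lt_of_lt_of_eq this (Eq.symm ?_)
  rw [cartanForm_apply]
  simp only [dotProduct, Matrix.mulVec, Matrix.of_apply, Finset.mul_sum, star_trivial]
  refine Finset.sum_congr rfl fun s _ => Finset.sum_congr rfl fun t _ => ?_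
  split_ifs with h
  · subst h
    rw [hdiag]
    push_cast
    have := Real.mul_self_sqrt (hN s).le
    linear_combination (- x s * x s) * this
  · have hc : (C s t : ℝ) ≤ 0 := by exact_mod_cast hle s t h
    have e : √(N s) * √(N t) * √((C s t : ℝ) * C t s) = -(C s t * N s) := by
      rw [← Real.sqrt_mul (hN s).le, ← Real.sqrt_mul (mul_pos (hN s) (hN t)).le,
        show N s * N t * ((C s t : ℝ) * C t s) = (-(C s t * N s)) ^ 2 by
          linear_combination (-C s t * N s) * hsym s t]
      exact Real.sqrt_sq (by nlinarith [hN s])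
    linear_combination (x s * x t / 2) * e

lemma cartanForm_int {C : S → S → ℤ} {N : S → ℝ} {m : ℝ} {x y : S → ℝ}
    (hx : ∀ t, ∃ j : ℤ, x t * N t = j * m) (hy : ∀ t, ∃ k : ℤ, y t = k) :
    ∃ z : ℤ, 2 * cartanForm C N x y = z * m := by
  choose j hj using hx
  choose k hk using hy
  refine ⟨∑ s, ∑ t, j s * C s t * k t, ?_⟩
  rw [cartanForm_apply]
  push_cast
  rw [Finset.mul_sum, Finset.sum_mul]
  refine Finset.sum_congr rfl fun s _ => ?_
  rw [Finset.mul_sum, Finset.sum_mul]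
  refine Finset.sum_congr rfl fun t _ => ?_
  rw [hk]
  linear_combination (C s t * k t : ℝ) * hj s

lemma cartanForm_self_int {C : S → S → ℤ} {N : S → ℝ} {m : ℝ} {x : S → ℝ}
    (hdiag : ∀ s, C s s = 2) (hsym : ∀ s t, (C s t : ℝ) * N s = C t s * N t)
    (hx : ∀ t, ∃ j : ℤ, x t * N t = j * m) (hx' : ∀ t, ∃ k : ℤ, x t = k) :
    ∃ z : ℤ, cartanForm C N x x = z * m := by
  choose j hj using hx
  choose k hk using hx'
  rw [cartanForm_apply]
  have key : ∀ T : Finset S, ∃ z : ℤ,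
      ∑ s ∈ T, ∑ t ∈ T, x s * ((C s t : ℝ) * N s / 2) * x t = z * m := by
    intro T
    induction T using Finset.induction with
    | empty => exact ⟨0, by simp⟩
    | insert a T ha ih =>
      obtain ⟨z, hz⟩ := ih
      refine ⟨z + k a * j a + ∑ t ∈ T, j a * C a t * k t, ?_⟩
      rw [Finset.sum_insert ha, Finset.sum_insert ha]
      simp_rw [Finset.sum_insert ha]
      rw [Finset.sum_add_distrib, hz]
      have e1 : ∑ s ∈ T, x s * ((C s a : ℝ) * N s / 2) * x a =
          ∑ t ∈ T, x a * ((C a t : ℝ) * N a / 2) * x t := by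
        refine Finset.sum_congr rfl fun s _ => ?_
        rw [hsym]; ring
      have e2 : 2 * ∑ t ∈ T, x a * ((C a t : ℝ) * N a / 2) * x t =
          (∑ t ∈ T, (j a * C a t * k t : ℝ)) * m := by
        rw [Finset.mul_sum, Finset.sum_mul]
        refine Finset.sum_congr rfl fun t _ => ?_
        rw [hk t]
        linear_combination (C a t * k t : ℝ) * hj a
      rw [e1, hdiag]
      push_cast
      linear_combination e2 + x a * hj a + j a * m * hk a
  exact key Finset.univ

/-- The set of roots: nonzero integral vectors `x` whose coroot `2x/(x,x)` lies in the
coroot lattice. -/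
def cartanRoots (C : S → S → ℤ) (N : S → ℝ) : Set (S → ℝ) :=
  {x | x ≠ 0 ∧ (∀ t, ∃ k : ℤ, x t = k) ∧ ∀ t, ∃ j : ℤ, x t * N t = j * cartanForm C N x x}

lemma single_mem_cartanRoots {C : S → S → ℤ} {N : S → ℝ} (hdiag : ∀ s, C s s = 2) (s : S) :
    (Pi.single s 1 : S → ℝ) ∈ cartanRoots C N := by
  refine ⟨by simp, fun t => ?_, fun t => ?_⟩
  · by_cases h : t = s
    · subst h; exact ⟨1, by simp⟩
    · exact ⟨0, by simp [h]⟩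
  · rw [cartanForm_single, hdiag]
    by_cases h : t = s
    · subst h; exact ⟨1, by simp⟩
    · exact ⟨0, by simp [h]⟩

lemma cartanRoots_finite {C : S → S → ℤ} {N : S → ℝ} (hdiag : ∀ s, C s s = 2)
    (hsym : ∀ s t, (C s t : ℝ) * N s = C t s * N t)
    (hpos : ∀ x : S → ℝ, x ≠ 0 → 0 < cartanForm C N x x) :
    (cartanRoots C N).Finite := by
  set B := cartanForm C N with hB
  have hBsymm : LinearMap.IsSymm B := ⟨fun x y => cartanForm_symm hsym x y⟩
  have hnn : ∀ x, 0 ≤ B x x := by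
    intro x
    by_cases h : x = 0
    · simp [h]
    · exact (hpos x h).le
  let e : S → S → ℝ := fun s => Pi.single s 1
  have hNe : ∀ s, 0 < B (e s) (e s) := fun s => hpos _ (by simp [e])
  let f : (S → ℝ) → S → ℝ := fun x s => 2 * B (e s) x / B (e s) (e s)
  refine Set.Finite.of_injOn (f := f)
    (t := Set.pi Set.univ (fun _ => (fun n : ℤ => (n : ℝ)) '' Set.Icc (-4) 4)) ?_ ?_ ?_
  · intro x hx s _
    have hxp := hpos x hx.1
    obtain ⟨p, hp⟩ := cartanForm_int (C := C) (single_mem_cartanRoots (N := N) hdiag s).2.2 hx.2.1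
    obtain ⟨q, hq⟩ := cartanForm_int (C := C) hx.2.2 (single_mem_cartanRoots (C := C) (N := N) hdiag s).2.1
    change 2 * B (e s) x = p * B (e s) (e s) at hp
    change 2 * B x (e s) = q * B x x at hq
    refine ⟨p, ?_, ?_⟩
    · have hcs := B.apply_sq_le_of_symm hnn hBsymm (e s) x
      have hsy : B x (e s) = B (e s) x := cartanForm_symm hsym _ _
      rw [hsy] at hq
      set β := B (e s) x
      set u := B (e s) (e s)
      set v := B x x
      have hu := hNe s
      have huv : 0 < u * v := mul_pos hu hxp
      have h4 : (p * q : ℝ) * (u * v) = 4 * β ^ 2 := by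
        linear_combination (- q * v) * hp - (2 * β) * hq
      have h5 : (p * q : ℝ) ≤ 4 := by
        by_contra! h
        nlinarith
      have h6 : (0 : ℝ) ≤ p * q := by
        by_contra! h
        nlinarith [sq_nonneg β]
      have h5' : p * q ≤ 4 := by exact_mod_cast h5
      have h6' : 0 ≤ p * q := by exact_mod_cast h6
      have h7 : q = 0 → p = 0 := by
        intro h
        rw [h] at hq
        have : β = 0 := by simpa using hq
        rw [this] at hp
        have : (p : ℝ) = 0 := by
          have hpu : (p : ℝ) * u = 0 := by rw [← hp, mul_zero]
          exact (mul_eq_zero.mp hpu).resolve_right hu.ne'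
        exact_mod_cast this
      rcases lt_trichotomy q 0 with h | h | h
      · constructor <;> nlinarith
      · rw [h7 h]; simp
      · constructor <;> nlinarith
    · simp only [f]
      rw [hp]
      field_simp [(hNe s).ne']
  · intro x _ y _ hxy
    by_contra hne
    have h1 : ∀ s, B (e s) (x - y) = 0 := by
      intro s
      have := congrFun hxy s
      simp only [f] at this
      rw [div_left_inj' (hNe s).ne'] at this
      rw [map_sub]; linarith
    have h2 := hpos (x - y) (sub_ne_zero.mpr hne)
    have h3 : x - y = ∑ s, (x - y) s • e s := by
      ext t; simp [e, Finset.sum_apply, Pi.single_apply]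
    have h4 : B (x - y) (x - y) = 0 := by
      nth_rewrite 1 [h3]
      rw [map_sum, LinearMap.sum_apply]
      refine Finset.sum_eq_zero fun s _ => ?_
      rw [map_smul, LinearMap.smul_apply, h1, smul_zero]
    exact absurd h4 h2.ne'
  · exact Set.Finite.pi fun _ => (Set.finite_Icc _ _).image _

lemma cartanRoots_refl {C : S → S → ℤ} {N : S → ℝ}
    (hsym : ∀ s t, (C s t : ℝ) * N s = C t s * N t)
    (hpos : ∀ x : S → ℝ, x ≠ 0 → 0 < cartanForm C N x x) {x y : S → ℝ}
    (hx : x ∈ cartanRoots C N) (hy : y ∈ cartanRoots C N) :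
    y - (2 / cartanForm C N x x * cartanForm C N x y) • x ∈ cartanRoots C N := by
  obtain ⟨p, hp⟩ := cartanForm_int (C := C) hx.2.2 hy.2.1
  obtain ⟨q, hq⟩ := cartanForm_int (C := C) hy.2.2 hx.2.1
  have hxp := hpos x hx.1
  have hyp := hpos y hy.1
  have e : 2 / cartanForm C N x x * cartanForm C N x y = p := by
    field_simp; linarith
  rw [e]
  have hs := cartanForm_symm hsym y x
  rw [hs] at hq
  have hB : cartanForm C N (y - (p : ℝ) • x) (y - (p : ℝ) • x) = cartanForm C N y y := by
    simp only [map_sub, map_smul, LinearMap.sub_apply, LinearMap.smul_apply, smul_eq_mul]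
    rw [hs]
    linear_combination (-p : ℝ) * hp
  refine ⟨?_, fun t => ?_, fun t => ?_⟩
  · intro h
    rw [h] at hB
    simp at hB
    linarith
  · obtain ⟨k, hk⟩ := hx.2.1 t
    obtain ⟨l, hl⟩ := hy.2.1 t
    exact ⟨l - p * k, by simp [hk, hl]⟩
  · rw [hB]
    obtain ⟨k, hk⟩ := hx.2.2 t
    obtain ⟨l, hl⟩ := hy.2.2 t
    refine ⟨l - k * q, ?_⟩
    simp only [Pi.sub_apply, Pi.smul_apply, smul_eq_mul]
    push_cast
    linear_combination hl - p * hk + k * hp - k * hq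

lemma cartanRoots_smul {C : S → S → ℤ} {N : S → ℝ} (hdiag : ∀ s, C s s = 2)
    (hsym : ∀ s t, (C s t : ℝ) * N s = C t s * N t)
    (hpos : ∀ x : S → ℝ, x ≠ 0 → 0 < cartanForm C N x x) {x : S → ℝ} {c : ℝ}
    (hx : x ∈ cartanRoots C N) (hy : c • x ∈ cartanRoots C N) : ∃ z : ℤ, z * c = 1 := by
  have hxp := hpos x hx.1
  have hc : c ≠ 0 := by
    rintro rfl
    exact hy.1 (by simp)
  obtain ⟨z, hz⟩ := cartanForm_self_int (C := C) (N := N) (m := c * cartanForm C N x x) hdiag hsym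
    (x := x) (fun t => by
      obtain ⟨j, hj⟩ := hy.2.2 t
      refine ⟨j, mul_left_cancel₀ hc ?_⟩
      simp only [Pi.smul_apply, smul_eq_mul, map_smul, LinearMap.smul_apply] at hj
      linear_combination hj) hx.2.1
  refine ⟨z, mul_right_cancel₀ hxp.ne' ?_⟩
  linear_combination -hz

lemma cartanRoots_reduced {C : S → S → ℤ} {N : S → ℝ} (hdiag : ∀ s, C s s = 2)
    (hsym : ∀ s t, (C s t : ℝ) * N s = C t s * N t)
    (hpos : ∀ x : S → ℝ, x ≠ 0 → 0 < cartanForm C N x x) {x : S → ℝ} {c : ℝ}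
    (hx : x ∈ cartanRoots C N) (hy : c • x ∈ cartanRoots C N) : c = 1 ∨ c = -1 := by
  obtain ⟨z, hz⟩ := cartanRoots_smul hdiag hsym hpos hx hy
  have hc : c ≠ 0 := by
    rintro rfl
    simp at hz
  obtain ⟨w, hw⟩ := cartanRoots_smul (c := c⁻¹) hdiag hsym hpos hy
    (by rw [smul_smul, inv_mul_cancel₀ hc, one_smul]; exact hx)
  have hcw : c = w := by
    field_simp at hw
    exact hw.symm
  rw [hcw] at hz
  have hzw : z * w = 1 := by exact_mod_cast hz
  rcases Int.eq_one_or_neg_one_of_mul_eq_one' hzw with h | h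
  · left; simp [hcw, h.2]
  · right; simp [hcw, h.2]

lemma cartanRoots_neg {C : S → S → ℤ} {N : S → ℝ} {x : S → ℝ}
    (hx : x ∈ cartanRoots C N) : -x ∈ cartanRoots C N := by
  refine ⟨neg_ne_zero.mpr hx.1, fun t => ?_, fun t => ?_⟩
  · obtain ⟨k, hk⟩ := hx.2.1 t
    exact ⟨-k, by simp [hk]⟩
  · obtain ⟨k, hk⟩ := hx.2.2 t
    exact ⟨-k, by simp [hk]⟩

lemma cartanRoots_sign {C : S → S → ℤ} {N : S → ℝ} (hdiag : ∀ s, C s s = 2)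
    (hle : ∀ s t, s ≠ t → C s t ≤ 0) (hN : ∀ s, 0 < N s)
    (hsym : ∀ s t, (C s t : ℝ) * N s = C t s * N t)
    (hpos : ∀ x : S → ℝ, x ≠ 0 → 0 < cartanForm C N x x) {x : S → ℝ}
    (hx : x ∈ cartanRoots C N) : (∀ s, 0 ≤ x s) ∨ (∀ s, x s ≤ 0) := by
  by_contra! hcon
  obtain ⟨⟨s, hs⟩, ⟨t, ht⟩⟩ := hcon
  have main : ∀ w : S → ℝ, w ≠ 0 → (∀ u, w u = x u ∨ w u = - x u ∨ w u = 0) →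
      cartanForm C N x x ≤ cartanForm C N w w := by
    intro w hw hwu
    obtain ⟨z, hz⟩ := cartanForm_self_int (C := C) (N := N) (m := cartanForm C N x x) hdiag hsym
      (x := w) (fun u => by
        obtain ⟨j, hj⟩ := hx.2.2 u
        rcases hwu u with h | h | h
        · exact ⟨j, by rw [h, hj]⟩
        · exact ⟨-j, by rw [h]; push_cast; linarith⟩
        · exact ⟨0, by simp [h]⟩) (fun u => by
        obtain ⟨j, hj⟩ := hx.2.1 u
        rcases hwu u with h | h | h
        · exact ⟨j, by rw [h, hj]⟩
        · exact ⟨-j, by rw [h]; push_cast; linarith⟩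
        · exact ⟨0, by simp [h]⟩)
    have hxp := hpos x hx.1
    have hwp := hpos w hw
    rw [hz] at hwp ⊢
    have hz0 : (0 : ℝ) < z := pos_of_mul_pos_left hwp hxp.le
    have hz1 : (1 : ℝ) ≤ z := by
      have : 0 < z := by exact_mod_cast hz0
      exact_mod_cast this
    nlinarith
  let y : S → ℝ := fun u => max (x u) 0
  let z : S → ℝ := fun u => max (-x u) 0
  have hxyz : x = y - z := by
    ext u
    simp only [y, z, Pi.sub_apply]
    rcases le_total (x u) 0 with h | h
    · rw [max_eq_right h, max_eq_left (by linarith)]; ring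
    · rw [max_eq_left h, max_eq_right (by linarith)]; ring
  have hy := main y (fun h => by
    have := congrFun h t
    simp only [y, Pi.zero_apply, max_eq_left ht.le] at this
    linarith) (fun u => by
      rcases le_total (x u) 0 with h | h
      · exact Or.inr (Or.inr (max_eq_right h))
      · exact Or.inl (max_eq_left h))
  have hz := main z (fun h => by
    have := congrFun h s
    simp only [z, Pi.zero_apply, max_eq_left (neg_nonneg.mpr hs.le)] at this
    linarith) (fun u => by
      rcases le_total (x u) 0 with h | h
      · exact Or.inr (Or.inl (max_eq_left (by linarith)))
      · exact Or.inr (Or.inr (max_eq_right (by linarith))))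
  have hyz : cartanForm C N y z ≤ 0 := by
    rw [cartanForm_apply]
    refine Finset.sum_nonpos fun u _ => Finset.sum_nonpos fun v _ => ?_
    have y0 : 0 ≤ y u := le_max_right _ _
    have z0 : 0 ≤ z v := le_max_right _ _
    by_cases h : u = v
    · subst h
      have : y u = 0 ∨ z u = 0 := by
        rcases le_total (x u) 0 with h | h
        · exact Or.inl (max_eq_right h)
        · exact Or.inr (max_eq_right (by linarith))
      rcases this with h | h <;> simp [h]
    · have hc : (C u v : ℝ) ≤ 0 := by exact_mod_cast hle u v h
      have h1 : (C u v : ℝ) * N u / 2 ≤ 0 := by nlinarith [hN u]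
      exact mul_nonpos_of_nonpos_of_nonneg (mul_nonpos_of_nonneg_of_nonpos y0 h1) z0
  have hexp : cartanForm C N x x =
      cartanForm C N y y - 2 * cartanForm C N y z + cartanForm C N z z := by
    rw [hxyz]
    simp only [map_sub, LinearMap.sub_apply]
    rw [cartanForm_symm hsym z y]
    ring
  have hxp := hpos x hx.1
  linarith

theorem cartan_backward (C : S → S → ℤ) (hdiag : ∀ s, C s s = 2)
    (hle : ∀ s t, s ≠ t → C s t ≤ 0)
    (hz : ∀ s t, C s t ≠ 0 ↔ C t s ≠ 0)
    (hM : (Matrix.of fun s t =>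
             if s = t then (1 : ℝ)
             else -(Real.sqrt ((C s t : ℝ) * (C t s : ℝ))) / 2).PosDef) :
    ∃ (rs : RealRootSystem) (b : S → rs.V),
        FiniteDimensional ℝ rs.V ∧
        rs.IsCrystallographic ∧ rs.IsReduced ∧ rs.IsBase b ∧
        ∀ s t, rs.coroot (b s) (b t) = (C s t : ℝ) := by
  obtain ⟨N, hN, hsym⟩ := cartan_symmetrizer C hle hz hM
  have hpos : ∀ x : S → ℝ, x ≠ 0 → 0 < cartanForm C N x x :=
    fun x hx => cartanForm_pos hdiag hle hN hsym hM hx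
  have hself : ∀ α ∈ cartanRoots C N,
      ((2 / cartanForm C N α α) • cartanForm C N α) α = 2 := by
    intro α hα
    have := (hpos α hα.1).ne'
    simp [this]
  have hmaps : ∀ α ∈ cartanRoots C N, ∀ x ∈ cartanRoots C N,
      x - ((2 / cartanForm C N α α) • cartanForm C N α) x • α ∈ cartanRoots C N := by
    intro α hα x hx
    simpa using cartanRoots_refl hsym hpos hα hx
  have hsum : ∀ x : S → ℝ, x = ∑ s, x s • (Pi.single s 1 : S → ℝ) := by
    intro x
    ext t; simp [Finset.sum_apply, Pi.single_apply]
  refine ⟨{ V := S → ℝ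
            R := cartanRoots C N
            finite_R := cartanRoots_finite hdiag hsym hpos
            spanning := ?_
            zero_notMem := fun h => h.1 rfl
            coroot := fun x => (2 / cartanForm C N x x) • cartanForm C N x
            coroot_self := hself
            refl_image := ?_ }, fun s => (Pi.single s 1 : S → ℝ), ?_, ?_, ?_, ?_, ?_⟩
  · rw [eq_top_iff]
    intro x _
    rw [hsum x]
    exact Submodule.sum_mem _ fun s _ => Submodule.smul_mem _ _
      (Submodule.subset_span (single_mem_cartanRoots hdiag s))
  · intro α hα
    apply Set.Subset.antisymm
    · rintro _ ⟨x, hx, rfl⟩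
      exact hmaps α hα x hx
    · intro x hx
      refine ⟨_, hmaps α hα x hx, ?_⟩
      have h2 := hself α hα
      generalize (2 / cartanForm C N α α) • cartanForm C N α = f at h2
      simp only [map_sub, map_smul, h2, smul_eq_mul]
      module
  · change FiniteDimensional ℝ (S → ℝ)
    infer_instance
  · intro α hα β hβ
    obtain ⟨z, hz⟩ := cartanForm_int (C := C) (x := α) (y := β) hα.2.2 hβ.2.1
    refine ⟨z, ?_⟩
    have := (hpos α hα.1).ne'
    change 2 / cartanForm C N α α * cartanForm C N α β = z
    field_simp
    linarith
  · intro α hα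
    ext β
    constructor
    · rintro ⟨hβ, c, rfl⟩
      rcases cartanRoots_reduced hdiag hsym hpos hα hβ with h | h
      · left
        rw [h]
        exact one_smul ℝ α
      · right
        rw [h]
        exact neg_one_smul ℝ α
    · rintro (rfl | rfl)
      · exact ⟨hα, 1, (one_smul ℝ β).symm⟩
      · exact ⟨cartanRoots_neg hα, -1, (neg_one_smul ℝ α).symm⟩
  · refine ⟨single_mem_cartanRoots hdiag, ?_, ?_⟩
    · exact Pi.linearIndependent_single_one S ℝ
    · intro α hα
      exact ⟨α, hsum α, cartanRoots_sign hdiag hle hN hsym hpos hα⟩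
  · intro s t
    change 2 / cartanForm C N (Pi.single s 1) (Pi.single s 1) *
      cartanForm C N (Pi.single s 1) (Pi.single t 1) = C s t
    rw [cartanForm_single, cartanForm_single, hdiag]
    have := (hN s).ne'
    push_cast
    field_simp

end Backward

/-- An integer matrix `C = (c_st)` is the Cartan matrix of a reduced
crystallographic root system, with respect to a base indexed by `S`, if and only if
(C1) `c_ss = 2`, `c_st ≤ 0` for `s ≠ t`, `c_st ≠ 0 ↔ c_ts ≠ 0`; and (C2) the symmetric
real matrix `M` with `M_ss = 1` and `M_st = -√(c_st·c_ts)/2` is positive definite. -/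
theorem cartanMatrix_iff {S : Type} [Fintype S] [DecidableEq S] (C : S → S → ℤ) :
    (∃ (rs : RealRootSystem) (b : S → rs.V),
        FiniteDimensional ℝ rs.V ∧
        rs.IsCrystallographic ∧ rs.IsReduced ∧ rs.IsBase b ∧
        ∀ s t, rs.coroot (b s) (b t) = (C s t : ℝ))
      ↔ ((∀ s, C s s = 2) ∧
         (∀ s t, s ≠ t → C s t ≤ 0) ∧
         (∀ s t, C s t ≠ 0 ↔ C t s ≠ 0) ∧
         (Matrix.of fun s t =>
             if s = t then (1 : ℝ)
             else -(Real.sqrt ((C s t : ℝ) * (C t s : ℝ))) / 2).PosDef) := by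
  constructor
  · rintro ⟨rs, b, -, -, -, hb, hC⟩
    exact cartan_forward C rs b hb hC
  · rintro ⟨h1, h2, h3, h4⟩
    exact cartan_backward C h1 h2 h3 h4
end

section
/- Let S be a finite set and C = (c_st)_{s,t∈S} an integer matrix satisfying (C1): c_ss = 2 for all s, c_st ≤ 0 for s ≠ t, and c_st ≠ 0 iff c_ts ≠ 0; and (C2): the symmetric real matrix M with M_ss = 1 and M_st = −√(c_st·c_ts)/2 for s ≠ t is positive definite. Then C is symmetrizable: there exist positive real numbers (d_s)_{s∈S} such that d_s·c_st = d_t·c_ts for all s, t ∈ S. -/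
/-- An integer matrix `C` satisfying (C1) and (C2) is symmetrizable:
there are positive reals `(d_s)` with `d_s·c_st = d_t·c_ts` for all `s, t`. -/
theorem cartanMatrix_symmetrizable {S : Type} [Fintype S] [DecidableEq S]
    (C : S → S → ℤ)
    (hC1a : ∀ s, C s s = 2)
    (hC1b : ∀ s t, s ≠ t → C s t ≤ 0)
    (hC1c : ∀ s t, C s t ≠ 0 ↔ C t s ≠ 0)
    (hC2 : (Matrix.of fun s t =>
        if s = t then (1 : ℝ)
        else -(Real.sqrt ((C s t : ℝ) * (C t s : ℝ))) / 2).PosDef) :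
    ∃ d : S → ℝ, (∀ s, 0 < d s) ∧ ∀ s t, d s * (C s t : ℝ) = d t * (C t s : ℝ) := by
  set M : Matrix S S ℝ := Matrix.of fun s t =>
        if s = t then (1 : ℝ)
        else -(Real.sqrt ((C s t : ℝ) * (C t s : ℝ))) / 2 with hM
  have hMd : ∀ s, M s s = 1 := by intro s; simp [hM]
  have hMo : ∀ s t, s ≠ t → M s t ≤ 0 := by
    intro s t h
    have := Real.sqrt_nonneg ((C s t : ℝ) * (C t s : ℝ))
    simp only [hM, Matrix.of_apply, if_neg h]
    linarith
  have hMn : ∀ s t, s ≠ t → C s t ≠ 0 → M s t ≤ -1/2 := by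
    intro s t h h0
    have h1 : C s t ≤ -1 := by have := hC1b s t h; omega
    have h2 : C t s ≤ -1 := by
      have := hC1b t s h.symm
      have := (hC1c s t).1 h0
      omega
    have h1' : (C s t : ℝ) ≤ -1 := by exact_mod_cast h1
    have h2' : (C t s : ℝ) ≤ -1 := by exact_mod_cast h2
    have : 1 ≤ Real.sqrt ((C s t : ℝ) * (C t s : ℝ)) := by
      rw [Real.one_le_sqrt]; nlinarith
    simp only [hM, Matrix.of_apply, if_neg h]
    linarith
  -- every nonempty subset has a vertex of degree at most one
  have key : ∀ T : Finset S, T.Nonempty → ∃ s ∈ T, 0 < ∑ t ∈ T, M s t := by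
    intro T hT
    by_contra! hcon
    have hx : (fun s => if s ∈ T then (1 : ℝ) else 0) ≠ 0 := by
      obtain ⟨s, hs⟩ := hT
      intro h
      have := congrFun h s
      simp [hs] at this
    have h := hC2.dotProduct_mulVec_pos hx
    have h2 : ∑ s ∈ T, ∑ t ∈ T, M s t ≤ 0 := Finset.sum_nonpos hcon
    simp [dotProduct, Matrix.mulVec] at h
    linarith
  have leaf : ∀ T : Finset S, T.Nonempty → ∃ s ∈ T, ∀ t ∈ T, ∀ u ∈ T, t ≠ s → u ≠ s →
      C s t ≠ 0 → C s u ≠ 0 → t = u := by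
    intro T hT
    obtain ⟨s, hs, hpos⟩ := key T hT
    refine ⟨s, hs, fun t ht u hu hts hus h1 h2 => ?_⟩
    by_contra htu
    have hsub : ({s, t, u} : Finset S) ⊆ T := by
      intro x hx
      simp only [Finset.mem_insert, Finset.mem_singleton] at hx
      rcases hx with rfl | rfl | rfl <;> assumption
    have hsum := Finset.sum_sdiff (f := fun t => M s t) hsub
    have hn : ∑ x ∈ T \ {s, t, u}, M s x ≤ 0 := by
      apply Finset.sum_nonpos
      intro x hx
      apply hMo
      rintro rfl
      simp at hx
    have h3 : ∑ x ∈ ({s, t, u} : Finset S), M s x = M s s + (M s t + M s u) := by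
      rw [Finset.sum_insert (by simp [hts.symm, hus.symm]), Finset.sum_pair htu]
    have := hMn s t hts.symm h1
    have := hMn s u hus.symm h2
    have := hMd s
    linarith
  have main : ∀ T : Finset S, ∃ d : S → ℝ, (∀ s, 0 < d s) ∧
      ∀ s ∈ T, ∀ t ∈ T, d s * (C s t : ℝ) = d t * (C t s : ℝ) := by
    intro T
    induction T using Finset.strongInduction with
    | H T ih =>
      rcases T.eq_empty_or_nonempty with rfl | hT
      · exact ⟨fun _ => 1, by simp, by simp⟩
      obtain ⟨s, hs, hl⟩ := leaf T hT
      obtain ⟨d, hd, hdC⟩ := ih (T.erase s) (Finset.erase_ssubset hs)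
      -- choose the new value at the leaf
      have hv : ∃ v : ℝ, 0 < v ∧ ∀ t ∈ T, t ≠ s → v * (C s t : ℝ) = d t * (C t s : ℝ) := by
        by_cases hex : ∃ t ∈ T, t ≠ s ∧ C s t ≠ 0
        · obtain ⟨t, ht, hts, h0⟩ := hex
          have h0' := (hC1c s t).1 h0
          have h1 : (C s t : ℝ) < 0 := by
            exact_mod_cast lt_of_le_of_ne (hC1b s t hts.symm) h0
          have h2 : (C t s : ℝ) < 0 := by
            exact_mod_cast lt_of_le_of_ne (hC1b t s hts) h0'
          refine ⟨d t * (C t s : ℝ) / (C s t : ℝ),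
            div_pos_of_neg_of_neg (mul_neg_of_pos_of_neg (hd t) h2) h1, fun u hu hus => ?_⟩
          by_cases hu0 : C s u = 0
          · have : C u s = 0 := by
              by_contra h
              exact (hC1c u s).1 h hu0
            simp [hu0, this]
          · have := hl t ht u hu hts hus h0 hu0
            subst this
            exact div_mul_cancel₀ _ h1.ne
        · push Not at hex
          refine ⟨1, one_pos, fun u hu hus => ?_⟩
          have hu0 := hex u hu hus
          have : C u s = 0 := by
            by_contra h
            exact (hC1c u s).1 h hu0
          simp [hu0, this]
      obtain ⟨v, hv0, hv⟩ := hv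
      refine ⟨Function.update d s v, fun x => ?_, fun x hx y hy => ?_⟩
      · by_cases h : x = s
        · subst h; simpa using hv0
        · simpa [h] using hd x
      · by_cases h : x = s
        · by_cases h' : y = s
          · rw [h, h']
          · rw [h]
            simpa [h'] using hv y hy h'
        · by_cases h' : y = s
          · rw [h']
            simpa [h] using (hv x hx h).symm
          · simpa [h, h'] using hdC x (Finset.mem_erase.2 ⟨h, hx⟩) y (Finset.mem_erase.2 ⟨h', hy⟩)
  obtain ⟨d, hd, h⟩ := main Finset.univ
  exact ⟨d, hd, fun s t => h s (Finset.mem_univ _) t (Finset.mem_univ _)⟩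
end

section
/- Let f : G → G' be a surjective homomorphism of groups whose kernel K is contained in the center of G, and let F : G → G and F' : G' → G' be group endomorphisms with f ∘ F = F' ∘ f. Write L(g) = g⁻¹F(g), G^F = {g ∈ G : F(g) = g}, G'^{F'} = {g' ∈ G' : F'(g') = g'} and L(K) = {z⁻¹F(z) : z ∈ K}. Then: (a) F(K) ⊆ K and L(K) is a subgroup of K; (b) if moreover the map L : G → G is surjective, then f(G^F) is a normal subgroup of G'^{F'} and there is a group isomorphism G'^{F'}/f(G^F) ≅ K/L(K), induced by sending g' ∈ G'^{F'} to the class of g⁻¹F(g) in K/L(K) for any g ∈ G with f(g) = g'. -/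
/-- The fixed-point subgroup `G^F = {g ∈ G : F(g) = g}` of a group endomorphism. -/
def fixedSubgroup {G : Type} [Group G] (F : G →* G) : Subgroup G where
  carrier := {g | F g = g}
  one_mem' := map_one F
  mul_mem' := fun {a b} ha hb => by
    have ha' : F a = a := ha
    have hb' : F b = b := hb
    show F (a * b) = a * b
    rw [map_mul, ha', hb']
  inv_mem' := fun {a} ha => by
    have ha' : F a = a := ha
    show F a⁻¹ = a⁻¹
    rw [map_inv, ha']

/-- Let `f : G → G'` be a surjective group homomorphism with
central kernel `K`, and `F`, `F'` endomorphisms with `f ∘ F = F' ∘ f`.  Then: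
(a) `F(K) ⊆ K` and `L(K) = {z⁻¹F(z) : z ∈ K}` is a subgroup of `K`; and
(b) if the Lang map `L : g ↦ g⁻¹F(g)` is surjective on `G`, then `f(G^F)` is a
normal subgroup of `G'^{F'}` and `G'^{F'}/f(G^F) ≅ K/L(K)`, the isomorphism being
induced by sending `g' ∈ G'^{F'}` to the class of `g⁻¹F(g)` for any `g` with
`f(g) = g'`. -/
theorem lang_exact_sequence {G G' : Type} [Group G] [Group G'] (f : G →* G')
    (hsurj : Function.Surjective f) (hcentral : f.ker ≤ Subgroup.center G)
    (F : G →* G) (F' : G' →* G') (hcomm : ∀ g : G, f (F g) = F' (f g)) :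
    ((∀ z ∈ f.ker, F z ∈ f.ker) ∧
      ∃ LK : Subgroup G,
        (LK : Set G) = (fun z => z⁻¹ * F z) '' (f.ker : Set G) ∧ LK ≤ f.ker) ∧
    ((Function.Surjective fun g : G => g⁻¹ * F g) →
      ∀ LK : Subgroup G,
        (LK : Set G) = (fun z => z⁻¹ * F z) '' (f.ker : Set G) →
        Subgroup.map f (fixedSubgroup F) ≤ fixedSubgroup F' ∧
        ((Subgroup.map f (fixedSubgroup F)).subgroupOf (fixedSubgroup F')).Normal ∧
        ∀ [_hn1 : ((Subgroup.map f (fixedSubgroup F)).subgroupOf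
              (fixedSubgroup F')).Normal]
          [_hn2 : (LK.subgroupOf f.ker).Normal],
          ∃ iso : (↥(fixedSubgroup F') ⧸
                    (Subgroup.map f (fixedSubgroup F)).subgroupOf (fixedSubgroup F'))
              ≃* (↥f.ker ⧸ LK.subgroupOf f.ker),
            ∀ (g : G) (h1 : f g ∈ fixedSubgroup F') (h2 : g⁻¹ * F g ∈ f.ker),
              iso (QuotientGroup.mk ⟨f g, h1⟩) = QuotientGroup.mk ⟨g⁻¹ * F g, h2⟩) := by
  have hc : ∀ z ∈ f.ker, ∀ g : G, g * z = z * g := fun z hz g =>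
    Subgroup.mem_center_iff.1 (hcentral hz) g
  have hFK : ∀ z ∈ f.ker, F z ∈ f.ker := by
    intro z hz
    rw [MonoidHom.mem_ker] at hz ⊢
    rw [hcomm, hz, map_one]
  have hL1 : ∀ z ∈ f.ker, z⁻¹ * F z ∈ f.ker := fun z hz =>
    mul_mem (inv_mem hz) (hFK z hz)
  -- the Lang map is multiplicative as soon as `g⁻¹ F(g)` is central
  have hmul : ∀ g h : G, g⁻¹ * F g ∈ f.ker →
      (g * h)⁻¹ * F (g * h) = (g⁻¹ * F g) * (h⁻¹ * F h) := by
    intro g h hg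
    have e := hc _ hg h⁻¹
    calc (g * h)⁻¹ * F (g * h) = (h⁻¹ * (g⁻¹ * F g)) * F h := by
          rw [map_mul]; group
      _ = _ := by rw [e]; group
  have hinv : ∀ g : G, g⁻¹ * F g ∈ f.ker →
      (g⁻¹)⁻¹ * F g⁻¹ = (g⁻¹ * F g)⁻¹ := by
    intro g hg
    have e := hmul g g⁻¹ hg
    rw [mul_inv_cancel, map_one, inv_one, one_mul] at e
    exact (inv_eq_of_mul_eq_one_right e.symm).symm
  refine ⟨⟨hFK, ⟨⟨⟨(fun z => z⁻¹ * F z) '' (f.ker : Set G), ?_⟩, ?_⟩, ?_⟩, rfl, ?_⟩, ?_⟩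
  · rintro _ _ ⟨a, ha, rfl⟩ ⟨b, hb, rfl⟩
    exact ⟨a * b, mul_mem ha hb, hmul a b (hL1 a ha)⟩
  · exact ⟨1, one_mem _, by simp⟩
  · rintro _ ⟨a, ha, rfl⟩
    exact ⟨a⁻¹, inv_mem ha, hinv a (hL1 a ha)⟩
  · rintro _ ⟨a, ha, rfl⟩
    exact hL1 a ha
  intro hL LK hLK
  have hmem : ∀ x, x ∈ LK ↔ ∃ z ∈ f.ker, z⁻¹ * F z = x := by
    intro x
    rw [← SetLike.mem_coe, hLK]
    rfl
  have hfix : ∀ g : G, f g ∈ fixedSubgroup F' ↔ g⁻¹ * F g ∈ f.ker := by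
    intro g
    rw [MonoidHom.mem_ker, map_mul, map_inv, hcomm, inv_mul_eq_one]
    exact eq_comm
  refine ⟨?_, ?_, ?_⟩
  · rintro _ ⟨a, ha, rfl⟩
    have ha' : F a = a := ha
    show F' (f a) = f a
    rw [← hcomm, ha']
  · constructor
    rintro ⟨x, hx⟩ hxm ⟨y, hy⟩
    obtain ⟨a, ha, hax⟩ := hxm
    have ha' : F a = a := ha
    have hax' : f a = x := hax
    obtain ⟨g, rfl⟩ := hsurj y
    refine ⟨g * a * g⁻¹, ?_, ?_⟩
    · show F (g * a * g⁻¹) = g * a * g⁻¹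
      have e := hc _ ((hfix g).1 hy) a
      have e2 : F g = g * (g⁻¹ * F g) := by group
      rw [map_mul, map_mul, map_inv, ha', e2]
      calc _ = g * ((g⁻¹ * F g) * a) * (g⁻¹ * F g)⁻¹ * g⁻¹ := by group
        _ = _ := by rw [← e]; group
    · show f (g * a * g⁻¹) = f g * x * (f g)⁻¹
      rw [map_mul, map_mul, map_inv, hax']
  · intro hn1 hn2
    have hwd : ∀ (g h : G) (hg : g⁻¹ * F g ∈ f.ker) (hh : h⁻¹ * F h ∈ f.ker), f g = f h →
        (QuotientGroup.mk ⟨g⁻¹ * F g, hg⟩ : ↥f.ker ⧸ LK.subgroupOf f.ker)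
          = QuotientGroup.mk ⟨h⁻¹ * F h, hh⟩ := by
      intro g h hg hh e
      have hz : g⁻¹ * h ∈ f.ker := by
        rw [MonoidHom.mem_ker, map_mul, map_inv, e, inv_mul_cancel]
      rw [QuotientGroup.eq, Subgroup.mem_subgroupOf]
      show (g⁻¹ * F g)⁻¹ * (h⁻¹ * F h) ∈ LK
      rw [hmem]
      refine ⟨g⁻¹ * h, hz, ?_⟩
      have e := hmul g (g⁻¹ * h) hg
      rw [mul_inv_cancel_left] at e
      rw [e, inv_mul_cancel_left]
    choose s hs using hsurj
    have hsK : ∀ x : fixedSubgroup F', (s x)⁻¹ * F (s x) ∈ f.ker := fun x =>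
      (hfix _).1 (by rw [hs]; exact x.2)
    let φ : fixedSubgroup F' →* (↥f.ker ⧸ LK.subgroupOf f.ker) :=
      MonoidHom.mk' (fun x => QuotientGroup.mk ⟨(s x)⁻¹ * F (s x), hsK x⟩) (by
        intro x y
        have hxy : (s x * s y)⁻¹ * F (s x * s y) ∈ f.ker := by
          rw [hmul _ _ (hsK x)]
          exact mul_mem (hsK x) (hsK y)
        rw [hwd (s ↑(x * y)) (s x * s y) (hsK _) hxy (by rw [map_mul, hs, hs, hs]; rfl),
          ← QuotientGroup.mk_mul]
        congr 1
        exact Subtype.ext (hmul _ _ (hsK x)))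
    have hφ : ∀ (g : G) (h1 : f g ∈ fixedSubgroup F') (h2 : g⁻¹ * F g ∈ f.ker),
        φ ⟨f g, h1⟩ = QuotientGroup.mk ⟨g⁻¹ * F g, h2⟩ := fun g h1 h2 =>
      hwd _ _ (hsK ⟨f g, h1⟩) h2 (hs _)
    have hker : (Subgroup.map f (fixedSubgroup F)).subgroupOf (fixedSubgroup F') = φ.ker := by
      ext ⟨x, hx⟩
      rw [Subgroup.mem_subgroupOf, MonoidHom.mem_ker]
      constructor
      · rintro ⟨a, ha, hax⟩
        have ha' : F a = a := ha
        have hax' : f a = x := hax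
        subst hax'
        rw [hφ a hx ((hfix a).1 hx), QuotientGroup.eq_one_iff, Subgroup.mem_subgroupOf]
        show a⁻¹ * F a ∈ LK
        rw [ha', inv_mul_cancel]
        exact one_mem _
      · intro h
        obtain ⟨g, rfl⟩ : ∃ g, f g = x := ⟨s x, hs x⟩
        have hg := (hfix g).1 hx
        rw [hφ g hx hg, QuotientGroup.eq_one_iff, Subgroup.mem_subgroupOf] at h
        obtain ⟨z, hz, hzg⟩ := (hmem _).1 h
        have hzg' : z⁻¹ * F z = g⁻¹ * F g := hzg
        refine ⟨g * z⁻¹, ?_, ?_⟩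
        · show F (g * z⁻¹) = g * z⁻¹
          have e := hmul g z⁻¹ hg
          rw [hinv z (hL1 z hz), hzg', mul_inv_cancel, inv_mul_eq_one] at e
          exact e.symm
        · show f (g * z⁻¹) = f g
          rw [map_mul, map_inv, MonoidHom.mem_ker.1 hz, inv_one, mul_one]
    have hφs : Function.Surjective φ := by
      intro q
      obtain ⟨⟨k, hk⟩, rfl⟩ := QuotientGroup.mk_surjective q
      obtain ⟨g, hg⟩ := hL k
      have hg' : g⁻¹ * F g = k := hg
      subst hg'
      exact ⟨⟨f g, (hfix g).2 hk⟩, hφ g _ hk⟩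
    refine ⟨(QuotientGroup.quotientMulEquivOfEq hker).trans
      (QuotientGroup.quotientKerEquivOfSurjective φ hφs), ?_⟩
    intro g h1 h2
    exact hφ g h1 h2
end

section
/- Let f : G → G' be a surjective homomorphism of groups whose kernel K is contained in the center of G, and let F : G → G and F' : G' → G' be group endomorphisms with f ∘ F = F' ∘ f. Assume that the map L : G → G, g ↦ g⁻¹F(g), is surjective and that K is finite. Then the fixed-point subgroups G^F = {g ∈ G : F(g) = g} and G'^{F'} = {g' ∈ G' : F'(g') = g'} have the same cardinality. -/
theorem card_eq_mul_of_surj {A B : Type} [Group A] [Group B] (φ : A →* B)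
    (h : Function.Surjective φ) : Nat.card A = Nat.card B * Nat.card φ.ker := by
  rw [Subgroup.card_eq_card_quotient_mul_card_subgroup φ.ker,
    Nat.card_congr (QuotientGroup.quotientKerEquivOfSurjective φ h).toEquiv]

/-- Let `f : G → G'` be a surjective group homomorphism with
central kernel, `F`, `F'` endomorphisms with `f ∘ F = F' ∘ f`, such that the Lang
map `g ↦ g⁻¹F(g)` is surjective and the kernel of `f` is finite.  Then the
fixed-point subgroups `G^F` and `G'^{F'}` have the same cardinality. -/
theorem card_fixedSubgroup_eq {G G' : Type} [Group G] [Group G'] (f : G →* G')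
    (hsurj : Function.Surjective f) (hcentral : f.ker ≤ Subgroup.center G)
    (F : G →* G) (F' : G' →* G') (hcomm : ∀ g : G, f (F g) = F' (f g))
    (hLang : Function.Surjective fun g : G => g⁻¹ * F g)
    (hker : Finite f.ker) :
    Nat.card (fixedSubgroup F) = Nat.card (fixedSubgroup F') := by
  have memH : ∀ g : G, F' (f g) = f g ↔ g⁻¹ * F g ∈ f.ker := by
    intro g
    rw [MonoidHom.mem_ker, map_mul, map_inv, hcomm, inv_mul_eq_one, eq_comm]
  let H : Subgroup G := (fixedSubgroup F').comap f
  let φ : H →* f.ker := MonoidHom.mk' (fun g => ⟨g.1⁻¹ * F g.1, (memH g.1).1 g.2⟩) (by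
    intro a b
    apply Subtype.ext
    have hc := Subgroup.mem_center_iff.1 (hcentral ((memH a.1).1 a.2)) b.1⁻¹
    show (a.1 * b.1)⁻¹ * F (a.1 * b.1) = (a.1⁻¹ * F a.1) * (b.1⁻¹ * F b.1)
    rw [map_mul, mul_inv_rev, ← mul_assoc (a.1⁻¹ * F a.1), ← hc]
    group)
  let ψ : H →* fixedSubgroup F' := MonoidHom.mk' (fun g => ⟨f g.1, g.2⟩) (by
    intro a b
    exact Subtype.ext (map_mul f a.1 b.1))
  have hφ : Function.Surjective φ := by
    rintro ⟨k, hk⟩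
    obtain ⟨g, hg⟩ := hLang k
    have hg' : g⁻¹ * F g = k := hg
    exact ⟨⟨g, (memH g).2 (hg' ▸ hk)⟩, Subtype.ext hg⟩
  have hψ : Function.Surjective ψ := by
    rintro ⟨k, hk⟩
    obtain ⟨g, rfl⟩ := hsurj k
    exact ⟨⟨g, hk⟩, rfl⟩
  have e1 : Nat.card φ.ker = Nat.card (fixedSubgroup F) := by
    refine Nat.card_congr
      { toFun := fun x => ⟨x.1.1, ?_⟩
        invFun := fun y => ⟨⟨y.1, ?_⟩, ?_⟩
        left_inv := fun _ => rfl
        right_inv := fun _ => rfl }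
    · have h : x.1.1⁻¹ * F x.1.1 = 1 := congrArg Subtype.val x.2
      exact (inv_mul_eq_one.1 h).symm
    · have h : F y.1 = y.1 := y.2
      show F' (f y.1) = f y.1
      rw [← hcomm, h]
    · have h : F y.1 = y.1 := y.2
      apply Subtype.ext
      show y.1⁻¹ * F y.1 = 1
      rw [h, inv_mul_cancel]
  have e2 : Nat.card ψ.ker = Nat.card f.ker := by
    refine Nat.card_congr
      { toFun := fun x => ⟨x.1.1, ?_⟩
        invFun := fun y => ⟨⟨y.1, ?_⟩, ?_⟩
        left_inv := fun _ => rfl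
        right_inv := fun _ => rfl }
    · exact congrArg Subtype.val x.2
    · have h : f y.1 = 1 := y.2
      show F' (f y.1) = f y.1
      rw [h, map_one]
    · exact Subtype.ext y.2
  have c1 := card_eq_mul_of_surj φ hφ
  have c2 := card_eq_mul_of_surj ψ hψ
  rw [e1] at c1
  rw [e2, c1, mul_comm] at c2
  exact Nat.eq_of_mul_eq_mul_right Nat.card_pos c2
end

section
/- Let G be a group with subgroups G₁, …, Gₙ such that the multiplication map G₁ × ⋯ × Gₙ → G, (g₁, …, gₙ) ↦ g₁⋯gₙ, is a group isomorphism (in particular the subgroups pairwise commute elementwise and every element of G has a unique such factorisation). Let F : G → G be a group endomorphism with F(G_i) = G_{i+1} for 1 ≤ i ≤ n−1 and F(Gₙ) = G₁. Then the map ι : G₁ → G, g ↦ g·F(g)·F²(g)⋯F^{n−1}(g), is an injective group homomorphism, and it restricts to a group isomorphism from {g ∈ G₁ : F^n(g) = g} onto G^F = {x ∈ G : F(x) = x}. -/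
/-- Let `G` be a group with subgroups `G₁, …, Gₙ` (here indexed by
`Fin (n+1)`) such that the multiplication map `G₁ × ⋯ × Gₙ → G` is a group
isomorphism, and let `F : G → G` be an endomorphism permuting the factors
cyclically: `F(Gᵢ) = Gᵢ₊₁` (indices mod `n+1`).  Then
`ι : G₁ → G`, `g ↦ g·F(g)⋯F^{n-1}(g)`, is an injective group homomorphism which
restricts to a group isomorphism from `{g ∈ G₁ : Fⁿ(g) = g}` onto
`G^F = {x ∈ G : F(x) = x}`. -/
theorem cyclic_factors_fixedPoints {G : Type} [Group G] {n : ℕ}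
    (Gs : Fin (n + 1) → Subgroup G)
    (hmulhom : ∀ g h : (∀ i, Gs i),
        (List.ofFn fun i => ((g * h) i : G)).prod
          = (List.ofFn fun i => ((g i : G))).prod * (List.ofFn fun i => ((h i : G))).prod)
    (hbij : Function.Bijective fun g : (∀ i, Gs i) =>
        (List.ofFn fun i => ((g i : G))).prod)
    (F : G →* G) (hF : ∀ i, Subgroup.map F (Gs i) = Gs (i + 1)) :
    Function.Injective (fun g : Gs 0 =>
        (List.ofFn fun k : Fin (n + 1) => (⇑F)^[(k : ℕ)] (g : G)).prod) ∧
    (∀ a b : Gs 0,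
        (List.ofFn fun k : Fin (n + 1) => (⇑F)^[(k : ℕ)] ((a * b : Gs 0) : G)).prod
          = (List.ofFn fun k : Fin (n + 1) => (⇑F)^[(k : ℕ)] ((a : G))).prod
            * (List.ofFn fun k : Fin (n + 1) => (⇑F)^[(k : ℕ)] ((b : G))).prod) ∧
    Set.BijOn (fun g : Gs 0 =>
        (List.ofFn fun k : Fin (n + 1) => (⇑F)^[(k : ℕ)] (g : G)).prod)
      {g : Gs 0 | (⇑F)^[n + 1] (g : G) = (g : G)}
      {x : G | F x = x} := by
  have hmem : ∀ i x, x ∈ Gs i → F x ∈ Gs (i + 1) := fun i x hx => by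
    rw [← hF i]; exact Subgroup.mem_map_of_mem F hx
  have hlast : ∀ x, x ∈ Gs (Fin.last n) → F x ∈ Gs 0 := fun x hx => by
    have := hmem _ x hx
    rwa [Fin.last_add_one] at this
  have hsucc : ∀ (i : Fin n) x, x ∈ Gs i.castSucc → F x ∈ Gs i.succ := fun i x hx => by
    have := hmem _ x hx
    rwa [Fin.coeSucc_eq_succ] at this
  have hit : ∀ (i : Fin (n + 1)) (g : Gs 0), (⇑F)^[(i : ℕ)] (g : G) ∈ Gs i := by
    intro i g
    induction i using Fin.induction with
    | zero => simp
    | succ i ih =>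
      have := hsucc i _ ih
      rw [Fin.val_succ, Function.iterate_succ_apply']
      exact this
  have hinj : Function.Injective (fun g : Gs 0 =>
        (List.ofFn fun k : Fin (n + 1) => (⇑F)^[(k : ℕ)] (g : G)).prod) := by
    intro a b hab
    have h := @hbij.1 (fun i => ⟨_, hit i a⟩) (fun i => ⟨_, hit i b⟩) hab
    have h0 := congrArg Subtype.val (congrFun h 0)
    exact Subtype.ext h0
  -- the key computation: the action of `F` on factorisations
  have key : ∀ g : (∀ i, Gs i), ∀ s : (∀ i, Gs i),
      ((s 0 : Gs 0) : G) = F (g (Fin.last n)) →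
      (∀ i : Fin n, (s i.succ : G) = F (g i.castSucc)) →
      F (List.ofFn fun i => (g i : G)).prod = (List.ofFn fun i => (s i : G)).prod := by
    intro g s h0 hs
    let A : ∀ i, Gs i := Fin.cons (1 : Gs 0) (fun i => s i.succ)
    let B : ∀ i, Gs i := Fin.cons (s 0) (fun i => (1 : Gs i.succ))
    have hAB : s = A * B := by
      funext i
      refine Fin.cases ?_ (fun j => ?_) i <;> simp [A, B]
    have hP := hmulhom A B
    rw [← hAB] at hP
    rw [hP, map_list_prod, List.map_ofFn, List.ofFn_succ', List.ofFn_succ, List.ofFn_succ]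
    simp [A, B, h0, hs, List.prod_concat, Function.comp_def]
  refine ⟨hinj, ?_, ?_, hinj.injOn, ?_⟩
  · intro a b
    have h := hmulhom (fun i => ⟨_, hit i a⟩) (fun i => ⟨_, hit i b⟩)
    rw [← h]
    congr 2
    funext i
    simp [iterate_map_mul]
  · intro g hg
    have hg' : (⇑F)^[n + 1] (g : G) = (g : G) := hg
    refine key (fun i => ⟨_, hit i g⟩) (fun i => ⟨_, hit i g⟩) ?_ ?_
    · rw [Function.iterate_succ_apply'] at hg'
      simpa using hg'.symm
    · intro i
      exact Function.iterate_succ_apply' _ _ _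
  · intro x hx
    have hx' : F x = x := hx
    obtain ⟨t, rfl⟩ := hbij.2 x
    let s : ∀ i, Gs i := Fin.cons (⟨_, hlast _ (t (Fin.last n)).2⟩ : Gs 0)
      (fun i => (⟨_, hsucc i _ (t i.castSucc).2⟩ : Gs i.succ))
    have hk := key t s rfl (fun i => rfl)
    have hst : s = t := hbij.1 (hk.symm.trans hx')
    have ht0 : F (t (Fin.last n)) = (t 0 : G) := congrArg Subtype.val (congrFun hst 0)
    have hts : ∀ i : Fin n, F (t i.castSucc) = (t i.succ : G) := fun i =>
      congrArg Subtype.val (congrFun hst i.succ)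
    have hall : ∀ i : Fin (n + 1), (⇑F)^[(i : ℕ)] (t 0 : G) = t i := by
      intro i
      induction i using Fin.induction with
      | zero => simp
      | succ i ih =>
        rw [Fin.val_succ, Function.iterate_succ_apply', ← hts i, ← ih]
        rfl
    refine ⟨t 0, ?_, ?_⟩
    · have := hall (Fin.last n)
      rw [Fin.val_last] at this
      change (⇑F)^[n + 1] (t 0 : G) = _
      rw [Function.iterate_succ_apply', this, ht0]
    · simp only [hall]
end
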